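/- arXiv:2404.03380 — 5 statements merged into one kernel-verified Lean document; each statement's English description precedes it below -/
import Mathlib

section
/- Quantitative softmax separation: let N ≥ 1, let s : Fin N → ℝ, let τ ∈ ℝ and δ > 0, let S = {i ∈ Fin N | s i = τ} be nonempty with cardinality |S|, and assume s i ≤ τ − δ for every i ∉ S. Then for every real c ≥ log(5N)/δ: (a) for every i ∉ S, softmax(c • s) i ≤ 1/(5N); and (b) for every i ∈ S, 4/(5·|S|) ≤ softmax(c • s) i ≤ 1/|S|. -/
/-- A score at least `δ` below `τ` has Boltzmann weight at most `exp (c * τ) / M` as soon as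
`c ≥ log M / δ`. -/
lemma exp_mul_le_exp_mul_div {M c τ δ x : ℝ} (hM : 1 ≤ M) (hδ : 0 < δ)
    (hc : Real.log M / δ ≤ c) (hx : x ≤ τ - δ) :
    Real.exp (c * x) ≤ Real.exp (c * τ) / M := by
  have hM0 : 0 < M := by linarith
  have hlog : Real.log M ≤ c * δ := (div_le_iff₀ hδ).1 hc
  have hc0 : 0 ≤ c := (div_nonneg (Real.log_nonneg hM) hδ.le).trans hc
  calc Real.exp (c * x) ≤ Real.exp (c * τ - Real.log M) :=
        Real.exp_le_exp.2 (by nlinarith [mul_le_mul_of_nonneg_left hx hc0])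
    _ = Real.exp (c * τ) / M := by rw [Real.exp_sub, Real.exp_log hM0]


open Finset

/-- Row-wise softmax of a score vector. -/
noncomputable def softmax {N : ℕ} (s : Fin N → ℝ) : Fin N → ℝ :=
  fun j => Real.exp (s j) / ∑ l, Real.exp (s l)

/-- Quantitative softmax separation: if the non-maximal scores are at least `δ` below
the maximal value `τ`, then for every inverse temperature `c ≥ log(5N)/δ` the softmax
mass of each non-maximizer is at most `1/(5N)`, while each maximizer (there are `|S|`
of them, `S = {i | s i = τ}` nonempty) receives mass between `4/(5|S|)` and `1/|S|`. -/
theorem softmax_quantitative_separation (N : ℕ) (hN : 1 ≤ N) (s : Fin N → ℝ)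
    (τ δ : ℝ) (hδ : 0 < δ)
    (hne : ({i : Fin N | s i = τ}).Nonempty)
    (hout : ∀ i : Fin N, s i ≠ τ → s i ≤ τ - δ)
    (c : ℝ) (hc : Real.log (5 * N) / δ ≤ c) :
    (∀ i : Fin N, s i ≠ τ → softmax (c • s) i ≤ 1 / (5 * N)) ∧
    (∀ i : Fin N, s i = τ →
      4 / (5 * (({j : Fin N | s j = τ}).ncard : ℝ)) ≤ softmax (c • s) i ∧
      softmax (c • s) i ≤ 1 / (({j : Fin N | s j = τ}).ncard : ℝ)) := by
  classical
  have hN' : (1 : ℝ) ≤ N := by exact_mod_cast hN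
  have hcard : {j : Fin N | s j = τ}.ncard = #{j : Fin N | s j = τ} := by
    rw [← Set.ncard_coe_finset]
    simp
  have hK : (1 : ℝ) ≤ ({j : Fin N | s j = τ}.ncard : ℝ) := by
    exact_mod_cast (Set.ncard_pos (Set.toFinite _)).2 hne
  have hE : 0 < Real.exp (c * τ) := Real.exp_pos _
  have hsmall : ∀ i, s i ≠ τ → Real.exp (c * s i) ≤ Real.exp (c * τ) / (5 * N) := fun i hi =>
    exp_mul_le_exp_mul_div (by linarith) hδ hc (hout i hi)
  have hsum : ∑ i, (if s i = τ then Real.exp (c * τ) else 0) =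
      ({j : Fin N | s j = τ}.ncard : ℝ) * Real.exp (c * τ) := by
    rw [← Finset.sum_filter, Finset.sum_const, nsmul_eq_mul, hcard]
  have hlower : ({j : Fin N | s j = τ}.ncard : ℝ) * Real.exp (c * τ) ≤
      ∑ i, Real.exp (c * s i) := by
    rw [← hsum]
    refine Finset.sum_le_sum fun i _ => ?_
    split_ifs with h
    · rw [h]
    · positivity
  have hupper : ∑ i, Real.exp (c * s i) ≤
      ({j : Fin N | s j = τ}.ncard : ℝ) * Real.exp (c * τ) + Real.exp (c * τ) / 5 := by
    have hconst : ∑ _i : Fin N, Real.exp (c * τ) / (5 * N) = Real.exp (c * τ) / 5 := by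
      rw [Finset.sum_const, Finset.card_univ, Fintype.card_fin, nsmul_eq_mul]
      field_simp
    rw [← hsum, ← hconst, ← Finset.sum_add_distrib]
    refine Finset.sum_le_sum fun i _ => ?_
    split_ifs with h
    · rw [h]
      exact le_add_of_nonneg_right (by positivity)
    · simpa using hsmall i h
  simp only [softmax, Pi.smul_apply, smul_eq_mul]
  generalize ({j : Fin N | s j = τ}.ncard : ℝ) = K at *
  generalize ∑ i, Real.exp (c * s i) = Z at *
  have hEZ : Real.exp (c * τ) ≤ Z := by nlinarith
  have hZ : 0 < Z := hE.trans_le hEZ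
  refine ⟨fun i hi => ?_, fun i hi => ?_⟩
  · rw [div_le_iff₀ hZ, one_div_mul_eq_div]
    exact (hsmall i hi).trans (by gcongr)
  · rw [hi]
    constructor
    · rw [div_le_div_iff₀ (by linarith) hZ]
      nlinarith
    · rw [div_le_div_iff₀ hZ (by linarith)]
      linarith
end

section
/- Modular cosine-sum characterization: let M ≥ 2 be a natural number, let d ≥ 1, and let v : Fin d → ℤ. Then ∑_{k} cos(2π · v_k / M) ≤ d, with equality if and only if (M : ℤ) divides v_k for every k ∈ Fin d; moreover, if some v_k is not divisible by M, then ∑_{k} cos(2π · v_k / M) ≤ d − 1/M². -/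
open Finset Real

theorem cos_two_pi_mul_div_eq_one {M : ℕ} (hM : M ≠ 0) {a : ℤ} (ha : (M : ℤ) ∣ a) :
    Real.cos (2 * Real.pi * (a : ℝ) / (M : ℝ)) = 1 := by
  obtain ⟨c, rfl⟩ := ha
  have hM' : (M : ℝ) ≠ 0 := Nat.cast_ne_zero.mpr hM
  rw [Real.cos_eq_one_iff]
  refine ⟨c, ?_⟩
  push_cast
  field_simp

theorem cos_two_pi_mul_div_le {M : ℕ} (hM : M ≠ 0) {a : ℤ} (ha : ¬ (M : ℤ) ∣ a) :
    Real.cos (2 * Real.pi * (a : ℝ) / (M : ℝ)) ≤ 1 - 8 / (M : ℝ) ^ 2 := by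
  have hM0 : (0 : ℝ) < M := Nat.cast_pos.mpr (Nat.pos_of_ne_zero hM)
  set r := a.bmod M with hr
  have hr0 : r ≠ 0 := fun h => ha (Int.dvd_iff_bmod_eq_zero.mpr h)
  have hcos : Real.cos (2 * Real.pi * (a : ℝ) / (M : ℝ)) =
      Real.cos (2 * Real.pi * (r : ℝ) / (M : ℝ)) := by
    have h : (a : ℝ) = r + M * (a.bdiv M : ℤ) := by
      exact_mod_cast (Int.bmod_add_bdiv a M).symm
    rw [h, ← Real.cos_add_int_mul_two_pi (2 * Real.pi * (r : ℝ) / (M : ℝ)) (a.bdiv M)]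
    congr 1
    field_simp
  have habs : 2 * |(r : ℝ)| ≤ M := by
    have h : 2 * |r| ≤ M := by
      have h₁ := Int.le_bmod (x := a) (Nat.pos_of_ne_zero hM)
      have h₂ := Int.bmod_le (x := a) (Nat.pos_of_ne_zero hM)
      rw [← hr] at h₁ h₂
      rcases abs_cases r with h | h <;> omega
    exact_mod_cast h
  have hsq : (1 : ℝ) ≤ (r : ℝ) ^ 2 := by
    exact_mod_cast Int.one_le_abs (pow_ne_zero 2 hr0) |>.trans_eq (abs_of_nonneg (sq_nonneg r))
  have hle : |2 * Real.pi * (r : ℝ) / (M : ℝ)| ≤ Real.pi := by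
    rw [abs_div, abs_mul, abs_of_pos Real.two_pi_pos, abs_of_pos hM0, div_le_iff₀ hM0]
    nlinarith [Real.pi_pos]
  rw [hcos]
  calc Real.cos (2 * Real.pi * (r : ℝ) / (M : ℝ))
      ≤ 1 - 2 / Real.pi ^ 2 * (2 * Real.pi * (r : ℝ) / (M : ℝ)) ^ 2 :=
        Real.cos_le_one_sub_mul_cos_sq hle
    _ = 1 - 8 * (r : ℝ) ^ 2 / (M : ℝ) ^ 2 := by
        field_simp
        ring
    _ ≤ 1 - 8 / (M : ℝ) ^ 2 := by
        gcongr
        linarith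

/-- Modular cosine-sum characterization: `∑ k, cos(2π v_k / M) ≤ d`, with equality iff
`M` divides every `v_k`; moreover if some `v_k` is not divisible by `M`, the sum is at
most `d - 1/M²`. -/
theorem cosine_sum_modular (M d : ℕ) (hM : 2 ≤ M) (hd : 1 ≤ d) (v : Fin d → ℤ) :
    (∑ k, Real.cos (2 * Real.pi * (v k : ℝ) / (M : ℝ)) ≤ (d : ℝ)) ∧
    ((∑ k, Real.cos (2 * Real.pi * (v k : ℝ) / (M : ℝ)) = (d : ℝ)) ↔
      ∀ k, (M : ℤ) ∣ v k) ∧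
    ((∃ k, ¬ (M : ℤ) ∣ v k) →
      ∑ k, Real.cos (2 * Real.pi * (v k : ℝ) / (M : ℝ)) ≤ (d : ℝ) - 1 / (M : ℝ) ^ 2) := by
  have hM0 : M ≠ 0 := by omega
  have hinv : (0 : ℝ) < 1 / (M : ℝ) ^ 2 := by positivity
  have hgap : (∃ k, ¬ (M : ℤ) ∣ v k) →
      ∑ k, Real.cos (2 * Real.pi * (v k : ℝ) / (M : ℝ)) ≤ (d : ℝ) - 1 / (M : ℝ) ^ 2 := by
    rintro ⟨k, hk⟩
    have hk' := cos_two_pi_mul_div_le hM0 hk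
    have hdef : 1 - Real.cos (2 * Real.pi * (v k : ℝ) / (M : ℝ)) ≤
        ∑ j, (1 - Real.cos (2 * Real.pi * (v j : ℝ) / (M : ℝ))) :=
      Finset.single_le_sum (f := fun j => 1 - Real.cos (2 * Real.pi * (v j : ℝ) / (M : ℝ)))
        (fun j _ => sub_nonneg.mpr (Real.cos_le_one _)) (Finset.mem_univ k)
    rw [Finset.sum_sub_distrib] at hdef
    simp only [Finset.sum_const, Finset.card_univ, Fintype.card_fin, nsmul_eq_mul,
      mul_one] at hdef
    have h8 : 8 / (M : ℝ) ^ 2 = 8 * (1 / (M : ℝ) ^ 2) := by ring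
    linarith
  have heq : (∀ k, (M : ℤ) ∣ v k) →
      ∑ k, Real.cos (2 * Real.pi * (v k : ℝ) / (M : ℝ)) = (d : ℝ) := fun h => by
    simp [fun k => cos_two_pi_mul_div_eq_one hM0 (h k)]
  refine ⟨?_, ⟨fun h => ?_, heq⟩, hgap⟩
  · by_cases h : ∀ k, (M : ℤ) ∣ v k
    · exact (heq h).le
    · linarith [hgap (not_forall.mp h)]
  · by_contra hn
    linarith [hgap (not_forall.mp hn)]
end

section
/- Index-matching cosine score: let n ≥ 1, r ≥ 1, and M be natural numbers with M ≥ 2 and n ≤ M, and let a, b : Fin r → Fin n (values viewed as integers in {0, …, n−1}). Then ∑_{l} cos(2π · (a_l − b_l) / M) = r if and only if a = b, and if a ≠ b then ∑_{l} cos(2π · (a_l − b_l) / M) ≤ r − 1/M². In particular the inner-product score used to select the tuples agreeing with a given multi-index attains its maximum value r exactly on the matching indices. -/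
theorem cos_two_pi_mul_int_div_le_of_two_mul_abs_le {M : ℕ} (hM : 0 < M) {e : ℤ} (he : e ≠ 0)
    (heM : 2 * |e| ≤ M) :
    Real.cos (2 * Real.pi * (e : ℝ) / (M : ℝ)) ≤ 1 - 8 / (M : ℝ) ^ 2 := by
  have hM' : (0 : ℝ) < M := by exact_mod_cast hM
  have heM' : 2 * |(e : ℝ)| ≤ M := by exact_mod_cast heM
  have he' : (1 : ℝ) ≤ (e : ℝ) ^ 2 := by
    exact_mod_cast Int.one_le_abs (pow_ne_zero 2 he) |>.trans_eq (abs_of_nonneg (sq_nonneg e))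
  have habs : |2 * Real.pi * (e : ℝ) / (M : ℝ)| ≤ Real.pi := by
    rw [abs_div, abs_mul, abs_of_pos Real.two_pi_pos, abs_of_pos hM', div_le_iff₀ hM']
    nlinarith [Real.pi_pos]
  calc Real.cos (2 * Real.pi * (e : ℝ) / (M : ℝ))
      ≤ 1 - 2 / Real.pi ^ 2 * (2 * Real.pi * (e : ℝ) / (M : ℝ)) ^ 2 :=
        Real.cos_le_one_sub_mul_cos_sq habs
    _ = 1 - 8 * (e : ℝ) ^ 2 / (M : ℝ) ^ 2 := by
        field_simp [Real.pi_ne_zero]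
        ring
    _ ≤ 1 - 8 / (M : ℝ) ^ 2 := by
        gcongr
        linarith

theorem cos_two_pi_mul_int_div_le_of_not_dvd {M : ℕ} (hM : 0 < M) {d : ℤ} (hd : ¬ (M : ℤ) ∣ d) :
    Real.cos (2 * Real.pi * (d : ℝ) / (M : ℝ)) ≤ 1 - 8 / (M : ℝ) ^ 2 := by
  have hM' : (M : ℝ) ≠ 0 := by exact_mod_cast hM.ne'
  have hsplit : d.bmod M + M * d.bdiv M = d := Int.bmod_add_bdiv d M
  have hne : d.bmod M ≠ 0 := fun h => hd ⟨d.bdiv M, by omega⟩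
  have hle : 2 * |d.bmod M| ≤ M := by
    have h₁ := Int.le_bmod (x := d) hM
    have h₂ := Int.bmod_lt (x := d) hM
    rw [← abs_two, ← abs_mul, abs_le]
    omega
  have hcast : (d : ℝ) = (d.bmod M : ℝ) + M * (d.bdiv M : ℝ) := by exact_mod_cast hsplit.symm
  have harg : 2 * Real.pi * (d : ℝ) / (M : ℝ) =
      2 * Real.pi * (d.bmod M : ℝ) / (M : ℝ) + (d.bdiv M : ℤ) * (2 * Real.pi) := by
    rw [hcast]
    field_simp
  rw [harg, Real.cos_add_int_mul_two_pi]
  exact cos_two_pi_mul_int_div_le_of_two_mul_abs_le hM hne hle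

open Finset Real

/-- Index-matching cosine score: for multi-indices `a b : Fin r → Fin n` with
`n ≤ M`, the score `∑ l, cos(2π (a_l - b_l) / M)` equals `r` iff `a = b`, and is
at most `r - 1/M²` otherwise; so the score attains its maximum `r` exactly on the
matching indices. -/
theorem index_matching_cosine_score (n r M : ℕ) (hn : 1 ≤ n) (hr : 1 ≤ r)
    (hM : 2 ≤ M) (hnM : n ≤ M) (a b : Fin r → Fin n) :
    ((∑ l, Real.cos (2 * Real.pi * (((a l : ℤ) - (b l : ℤ)) : ℝ) / (M : ℝ)) = (r : ℝ)) ↔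
      a = b) ∧
    (a ≠ b →
      ∑ l, Real.cos (2 * Real.pi * (((a l : ℤ) - (b l : ℤ)) : ℝ) / (M : ℝ)) ≤
        (r : ℝ) - 1 / (M : ℝ) ^ 2) := by
  have hM' : (0 : ℝ) < M := by exact_mod_cast (by omega : 0 < M)
  have hgap : a ≠ b →
      ∑ l, Real.cos (2 * Real.pi * (((a l : ℤ) - (b l : ℤ)) : ℝ) / (M : ℝ)) ≤
        (r : ℝ) - 1 / (M : ℝ) ^ 2 := by
    intro hab
    obtain ⟨k, hk⟩ := Function.ne_iff.mp hab
    have hndvd : ¬ (M : ℤ) ∣ (a k : ℤ) - (b k : ℤ) := by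
      intro hdvd
      have hval : (a k : ℕ) ≠ b k := fun h => hk (Fin.ext h)
      have ha := (a k).isLt
      have hb := (b k).isLt
      have := Int.eq_zero_of_abs_lt_dvd hdvd (by rw [abs_lt]; omega)
      omega
    have hterm := cos_two_pi_mul_int_div_le_of_not_dvd (by omega) hndvd
    rw [Int.cast_sub] at hterm
    have hrest : ∑ l ∈ univ.erase k,
        Real.cos (2 * Real.pi * (((a l : ℤ) - (b l : ℤ)) : ℝ) / (M : ℝ)) ≤ (r : ℝ) - 1 := by
      refine (sum_le_card_nsmul _ _ 1 fun l _ => Real.cos_le_one _).trans_eq ?_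
      simp [card_erase_of_mem, Nat.cast_sub hr]
    have hdiv : 1 / (M : ℝ) ^ 2 ≤ 8 / (M : ℝ) ^ 2 := by
      gcongr
      norm_num
    rw [← add_sum_erase univ _ (mem_univ k)]
    linarith
  refine ⟨⟨fun hsum => ?_, ?_⟩, hgap⟩
  · by_contra hab
    have hpos : 0 < 1 / (M : ℝ) ^ 2 := by positivity
    linarith [hgap hab]
  · rintro rfl
    simp
end

section
/- Positive lower bound for the Performer kernel on bounded inputs: let m ≥ 1, d ≥ 1, let w : Fin m → EuclideanSpace ℝ (Fin d) be fixed vectors, and let φ : EuclideanSpace ℝ (Fin d) → EuclideanSpace ℝ (Fin m) be the Performer feature map associated with w. Then for every C ≥ 0 and all x, y with ‖x‖ ≤ C and ‖y‖ ≤ C, the inner product ⟨φ(x), φ(y)⟩ satisfies ⟨φ(x), φ(y)⟩ ≥ (exp(−C²)/m) · ∑_{i} exp(−2C‖w_i‖), and in particular ⟨φ(x), φ(y)⟩ > 0. Consequently the denominator of kernelized Performer attention is uniformly bounded below by a positive constant on any bounded set of token features. -/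
open Finset Real
open scoped RealInnerProductSpace

/-- The Performer random-feature map: `φ(x)_i = (exp(-‖x‖²/2)/√m) · exp(⟨w_i, x⟩)`. -/
noncomputable def performerFeature {m d : ℕ} (w : Fin m → EuclideanSpace ℝ (Fin d))
    (x : EuclideanSpace ℝ (Fin d)) : EuclideanSpace ℝ (Fin m) :=
  (WithLp.equiv 2 (Fin m → ℝ)).symm
    (fun i => (Real.exp (-‖x‖ ^ 2 / 2) / Real.sqrt m) * Real.exp ⟪w i, x⟫)

/-- The Performer kernel is an average of exponentials of `-(‖x‖² + ‖y‖²)/2 + ⟨w_i, x + y⟩`. -/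
theorem inner_performerFeature {m d : ℕ} (w : Fin m → EuclideanSpace ℝ (Fin d))
    (x y : EuclideanSpace ℝ (Fin d)) :
    ⟪performerFeature w x, performerFeature w y⟫ =
      (∑ i, Real.exp (-(‖x‖ ^ 2 + ‖y‖ ^ 2) / 2 + ⟪w i, x + y⟫)) / m := by
  have hm : Real.sqrt m * Real.sqrt m = m := Real.mul_self_sqrt m.cast_nonneg
  rw [PiLp.inner_apply, Finset.sum_div]
  refine Finset.sum_congr rfl fun i _ => ?_
  have hexp : Real.exp (-(‖x‖ ^ 2 + ‖y‖ ^ 2) / 2 + ⟪w i, x + y⟫) =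
      Real.exp (-‖x‖ ^ 2 / 2) * Real.exp ⟪w i, x⟫ *
        (Real.exp (-‖y‖ ^ 2 / 2) * Real.exp ⟪w i, y⟫) := by
    simp only [← Real.exp_add, inner_add_right]
    congr 1
    ring
  rw [hexp, ← hm]
  simp only [performerFeature, WithLp.equiv_symm_apply, RCLike.inner_apply, conj_trivial]
  ring

/-- Cauchy–Schwarz lower bound for the exponents of the Performer kernel. -/
theorem performer_exponent_lower_bound {E : Type*} [NormedAddCommGroup E] [InnerProductSpace ℝ E]
    {C : ℝ} {x y : E} (v : E) (hx : ‖x‖ ≤ C) (hy : ‖y‖ ≤ C) :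
    -C ^ 2 + -2 * C * ‖v‖ ≤ -(‖x‖ ^ 2 + ‖y‖ ^ 2) / 2 + ⟪v, x + y⟫ := by
  have hxy : ‖x + y‖ ≤ 2 * C := (norm_add_le x y).trans (by linarith)
  have hinner : -(‖v‖ * ‖x + y‖) ≤ ⟪v, x + y⟫ := neg_le_of_abs_le (abs_real_inner_le_norm v (x + y))
  have hmul : ‖v‖ * ‖x + y‖ ≤ ‖v‖ * (2 * C) := by gcongr
  have hx2 : ‖x‖ ^ 2 ≤ C ^ 2 := by gcongr
  have hy2 : ‖y‖ ^ 2 ≤ C ^ 2 := by gcongr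
  linarith

/-- Positive lower bound for the Performer kernel on bounded inputs: for
`‖x‖ ≤ C`, `‖y‖ ≤ C`, the kernel `⟨φ(x), φ(y)⟩` is at least
`(exp(-C²)/m) · ∑ i, exp(-2C‖w_i‖)`, and in particular is strictly positive. -/
theorem performer_kernel_lower_bound (m d : ℕ) (hm : 1 ≤ m) (hd : 1 ≤ d)
    (w : Fin m → EuclideanSpace ℝ (Fin d)) (C : ℝ) (hC : 0 ≤ C)
    (x y : EuclideanSpace ℝ (Fin d)) (hx : ‖x‖ ≤ C) (hy : ‖y‖ ≤ C) :
    (Real.exp (-C ^ 2) / m) * (∑ i, Real.exp (-2 * C * ‖w i‖)) ≤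
      ⟪performerFeature w x, performerFeature w y⟫ ∧
    0 < ⟪performerFeature w x, performerFeature w y⟫ := by
  have hm0 : (0 : ℝ) < m := by exact_mod_cast hm
  have : Nonempty (Fin m) := ⟨⟨0, hm⟩⟩
  rw [inner_performerFeature]
  refine ⟨?_, div_pos (Finset.sum_pos (fun i _ => Real.exp_pos _) Finset.univ_nonempty) hm0⟩
  rw [div_mul_eq_mul_div, Finset.mul_sum]
  gcongr with i
  rw [← Real.exp_add]
  exact Real.exp_le_exp.mpr (performer_exponent_lower_bound (w i) hx hy)
end

section
/- Spectral monotonicity of Gram matrices under zero-padded row extension: let m1 ≤ m and p be natural numbers, and let Y1, Y2 : Matrix (Fin m) (Fin p) ℝ be such that the i-th rows of Y1 and Y2 coincide for every i with (i : ℕ) < m1, and the i-th row of Y1 is zero for every i with (i : ℕ) ≥ m1. Then for every j ∈ Fin m, the j-th smallest eigenvalue (counted with multiplicity, listed in nondecreasing order) of the real symmetric matrix Y1 * Y1ᵀ is at most the j-th smallest eigenvalue of Y2 * Y2ᵀ. -/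
open Finset Polynomial

open Matrix in
/-- A symmetric real matrix whose characteristic polynomial has monotone root list `μ` admits an
orthonormal basis of eigenvectors with eigenvalues `μ`. -/
theorem Matrix.IsHermitian.exists_orthonormalBasis_of_charpoly_eq {m : ℕ}
    {A : Matrix (Fin m) (Fin m) ℝ} (hA : A.IsHermitian) {μ : Fin m → ℝ} (hμ : Monotone μ)
    (h : A.charpoly = ∏ j, (X - C (μ j))) :
    ∃ b : OrthonormalBasis (Fin m) ℝ (EuclideanSpace ℝ (Fin m)),
      ∀ j, A *ᵥ ⇑(b j) = μ j • ⇑(b j) := by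
  set σ := Tuple.sort hA.eigenvalues
  have hroots : Multiset.map hA.eigenvalues Finset.univ.val = Multiset.map μ Finset.univ.val := by
    have h' := hA.roots_charpoly_eq_eigenvalues
    rw [h, Polynomial.roots_prod _ _ (prod_ne_zero_iff.2 fun j _ => X_sub_C_ne_zero _)] at h'
    simpa [Function.comp_def] using h'.symm
  have hperm : (List.ofFn (hA.eigenvalues ∘ σ)).Perm (List.ofFn μ) := by
    refine (Equiv.Perm.ofFn_comp_perm σ hA.eigenvalues).trans ?_
    rwa [Fin.univ_val_map, Fin.univ_val_map, Multiset.coe_eq_coe] at hroots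
  have heq : hA.eigenvalues ∘ σ = μ := List.ofFn_injective <|
    hperm.eq_of_sortedLE (Tuple.monotone_sort hA.eigenvalues).sortedLE_ofFn hμ.sortedLE_ofFn
  refine ⟨hA.eigenvectorBasis.reindex σ.symm, fun j => ?_⟩
  have hj : hA.eigenvalues (σ j) = μ j := congrFun heq j
  simpa [hj] using hA.mulVec_eigenvectorBasis (σ j)

open Matrix in
/-- The quadratic form of a real matrix in an orthonormal basis of eigenvectors. -/
theorem OrthonormalBasis.dotProduct_mulVec_eq_sum {ι : Type*} [Fintype ι]
    (b : OrthonormalBasis ι ℝ (EuclideanSpace ℝ ι)) {A : Matrix ι ι ℝ} {μ : ι → ℝ}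
    (hb : ∀ j, A *ᵥ ⇑(b j) = μ j • ⇑(b j)) (x : EuclideanSpace ℝ ι) :
    ⇑x ⬝ᵥ A *ᵥ ⇑x = ∑ j, μ j * inner ℝ (b j) x ^ 2 := by
  have hx : A *ᵥ ⇑x = ∑ j, (μ j * inner ℝ (b j) x) • ⇑(b j) := by
    conv_lhs => rw [← b.sum_repr' x]
    simp [Matrix.mulVec_sum, Matrix.mulVec_smul, hb, smul_smul, mul_comm]
  rw [hx, dotProduct_sum]
  refine sum_congr rfl fun j _ => ?_
  have : inner ℝ (b j) x = ⇑x ⬝ᵥ ⇑(b j) := by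
    simp [EuclideanSpace.inner_eq_star_dotProduct]
  rw [dotProduct_smul, ← this, smul_eq_mul]
  ring

/-- Given two bases of a space indexed by `Fin m`, some nonzero vector lies in the span of the
vectors of index `≥ j` of the first one and of the vectors of index `≤ j` of the second one. -/
theorem OrthonormalBasis.exists_ne_zero_inner_eq_zero {m : ℕ} {E : Type*} [NormedAddCommGroup E]
    [InnerProductSpace ℝ E] (b c : OrthonormalBasis (Fin m) ℝ E) (j : Fin m) :
    ∃ x : E, x ≠ 0 ∧ (∀ i < j, inner ℝ (b i) x = 0) ∧ ∀ i, j < i → inner ℝ (c i) x = 0 := by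
  have : FiniteDimensional ℝ E := b.toBasis.finiteDimensional_of_finite
  let T : E →ₗ[ℝ] ({i // i ≠ j} → ℝ) := LinearMap.pi fun i =>
    innerₛₗ ℝ (if i.1 < j then b i.1 else c i.1)
  have hT : LinearMap.ker T ≠ ⊥ := by
    apply LinearMap.ker_ne_bot_of_finrank_lt
    rw [Module.finrank_eq_card_basis b.toBasis, Module.finrank_fintype_fun_eq_card]
    exact Fintype.card_subtype_lt (x := j) (by simp)
  obtain ⟨x, hx, hx0⟩ := (Submodule.ne_bot_iff _).1 hT
  have hTx : ∀ i, i ≠ j → inner ℝ (if i < j then b i else c i) x = 0 :=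
    fun i hi => congrFun (LinearMap.mem_ker.1 hx) ⟨i, hi⟩
  refine ⟨x, hx0, fun i hi => ?_, fun i hi => ?_⟩
  · simpa [hi] using hTx i hi.ne
  · simpa [hi.not_gt] using hTx i hi.ne'

/-- Spectral monotonicity of Gram matrices under zero-padded row extension: if the
rows of `Y1` agree with those of `Y2` on indices `< m1` and vanish on indices `≥ m1`,
then the eigenvalues (with multiplicity, listed in nondecreasing order as the monotone
root lists `μ1`, `μ2` of the characteristic polynomials) of the Gram matrix `Y1 * Y1ᵀ`
are dominated entrywise by those of `Y2 * Y2ᵀ`. -/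
theorem gram_spectral_monotonicity (m m1 p : ℕ) (hm1 : m1 ≤ m)
    (Y1 Y2 : Matrix (Fin m) (Fin p) ℝ)
    (hrows : ∀ i : Fin m, (i : ℕ) < m1 → Y1 i = Y2 i)
    (hzero : ∀ i : Fin m, m1 ≤ (i : ℕ) → Y1 i = 0)
    (μ1 μ2 : Fin m → ℝ) (hμ1 : Monotone μ1) (hμ2 : Monotone μ2)
    (h1 : (Y1 * Y1.transpose).charpoly = ∏ j, (X - C (μ1 j)))
    (h2 : (Y2 * Y2.transpose).charpoly = ∏ j, (X - C (μ2 j))) :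
    ∀ j : Fin m, μ1 j ≤ μ2 j := by
  intro j
  have hsymm (Y : Matrix (Fin m) (Fin p) ℝ) : (Y * Y.transpose).IsHermitian := by
    simpa using Matrix.isHermitian_mul_conjTranspose_self Y
  have hquad (Y : Matrix (Fin m) (Fin p) ℝ) (v : Fin m → ℝ) :
      v ⬝ᵥ (Y * Y.transpose).mulVec v = Y.transpose.mulVec v ⬝ᵥ Y.transpose.mulVec v := by
    rw [← Matrix.mulVec_mulVec, Matrix.dotProduct_mulVec, Matrix.mulVec_transpose]
  obtain ⟨b, hb⟩ := (hsymm Y1).exists_orthonormalBasis_of_charpoly_eq hμ1 h1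
  obtain ⟨c, hc⟩ := (hsymm Y2).exists_orthonormalBasis_of_charpoly_eq hμ2 h2
  rcases le_or_gt (μ1 j) 0 with hj | hj
  · refine hj.trans ?_
    have hcj := c.dotProduct_mulVec_eq_sum hc (c j)
    simp only [c.inner_eq_ite, ite_pow, mul_ite] at hcj
    simp only [one_pow, mul_one, ne_eq, OfNat.ofNat_ne_zero, not_false_eq_true, zero_pow,
      mul_zero, sum_ite_eq', mem_univ, if_true] at hcj
    rw [← hcj, hquad]
    exact sum_nonneg fun i _ => mul_self_nonneg _
  obtain ⟨x, hx0, hbx, hcx⟩ := b.exists_ne_zero_inner_eq_zero c j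
  have hx (i : Fin m) (hi : m1 ≤ (i : ℕ)) : x i = 0 := by
    rw [← b.sum_repr' x]
    simp only [WithLp.ofLp_sum, WithLp.ofLp_smul, Finset.sum_apply, Pi.smul_apply, smul_eq_mul]
    refine sum_eq_zero fun k _ => ?_
    rcases lt_or_ge k j with hk | hk
    · rw [hbx k hk, zero_mul]
    · have hbk := congrFun (hb k) i
      have hrow : (Y1 * Y1.transpose) i = 0 := by
        ext l
        simp [Matrix.mul_apply, hzero i hi]
      rw [Matrix.mulVec, hrow, zero_dotProduct, Pi.smul_apply, smul_eq_mul, zero_eq_mul] at hbk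
      rw [hbk.resolve_left (hj.trans_le (hμ1 hk)).ne', mul_zero]
  have hY : Y1.transpose.mulVec ⇑x = Y2.transpose.mulVec ⇑x := by
    ext k
    simp only [Matrix.mulVec, dotProduct]
    refine sum_congr rfl fun i _ => ?_
    rcases lt_or_ge (i : ℕ) m1 with hi | hi
    · simp [Matrix.transpose_apply, hrows i hi]
    · simp [hx i hi]
  have hnorm (e : OrthonormalBasis (Fin m) ℝ (EuclideanSpace ℝ (Fin m))) (a : ℝ) :
      a * ‖x‖ ^ 2 = ∑ i, a * inner ℝ (e i) x ^ 2 := by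
    simp [← mul_sum, ← e.sum_sq_norm_inner_right x]
  have key : μ1 j * ‖x‖ ^ 2 ≤ μ2 j * ‖x‖ ^ 2 := by
    calc μ1 j * ‖x‖ ^ 2 = ∑ i, μ1 j * inner ℝ (b i) x ^ 2 := hnorm b _
      _ ≤ ∑ i, μ1 i * inner ℝ (b i) x ^ 2 := by
        refine sum_le_sum fun i _ => ?_
        rcases lt_or_ge i j with hi | hi
        · simp [hbx i hi]
        · exact mul_le_mul_of_nonneg_right (hμ1 hi) (sq_nonneg _)
      _ = ∑ i, μ2 i * inner ℝ (c i) x ^ 2 := by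
        rw [← b.dotProduct_mulVec_eq_sum hb, ← c.dotProduct_mulVec_eq_sum hc, hquad, hquad, hY]
      _ ≤ ∑ i, μ2 j * inner ℝ (c i) x ^ 2 := by
        refine sum_le_sum fun i _ => ?_
        rcases lt_or_ge j i with hi | hi
        · simp [hcx i hi]
        · exact mul_le_mul_of_nonneg_right (hμ2 hi) (sq_nonneg _)
      _ = μ2 j * ‖x‖ ^ 2 := (hnorm c _).symm
  exact le_of_mul_le_mul_right key (by positivity)
end
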